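/- For every integer k with 1 ≤ k < 37, there exists a positive integer n such that k·10^n + (10^n − 1)/9 is prime; consequently 37 is the minimal seed for the digit 1. -/

import Mathlib

/-!
Primality of the large extensions is proved by elliptic curve certificates. Given a point of prime
order `q` on the reduction of a short Weierstrass curve modulo every prime factor of `N`, the
elementary bound `2 p + 1` on the number of points modulo `p` (instead of Hasse's bound) shows that
`N` is prime as soon as `4 N < (q - 1) ^ 2`.
-/

open WeierstrassCurve

/-- The short Weierstrass curve `Y² = X³ + a X + b` through the point `(x, y)`. -/
def shortCurve {F : Type*} [Field F] (a x y : F) : Affine F :=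
  ⟨0, 0, 0, a, y ^ 2 - x ^ 3 - a * x⟩

section Jacobian

variable {F : Type*} [Field F] [DecidableEq F] {W : Affine F}

/-- The affine point `P` has Jacobian coordinates `(X : Y : Z)`. -/
def HasJacobianCoords (P : W.Point) (X Y Z : F) : Prop :=
  ∃ h, P = Affine.Point.some (X / Z ^ 2) (Y / Z ^ 3) h

theorem HasJacobianCoords.add_self (h₁ : W.a₁ = 0) (h₂ : W.a₂ = 0) (h₃ : W.a₃ = 0)
    {P : W.Point} {X Y Z : F} (hP : HasJacobianCoords P X Y Z) (hZ : 2 * Y * Z ≠ 0) :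
    HasJacobianCoords (P + P)
      ((3 * X ^ 2 + W.a₄ * Z ^ 4) ^ 2 - 8 * (X * Y ^ 2))
      ((3 * X ^ 2 + W.a₄ * Z ^ 4) *
        (4 * (X * Y ^ 2) - ((3 * X ^ 2 + W.a₄ * Z ^ 4) ^ 2 - 8 * (X * Y ^ 2))) - 8 * Y ^ 4)
      (2 * Y * Z) := by
  obtain ⟨h, rfl⟩ := hP
  have hz : Z ≠ 0 := right_ne_zero_of_mul hZ
  have hy : Y ≠ 0 := right_ne_zero_of_mul (left_ne_zero_of_mul hZ)
  have h2 : (2 : F) ≠ 0 := left_ne_zero_of_mul (left_ne_zero_of_mul hZ)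
  have hne : Y / Z ^ 3 ≠ W.negY (X / Z ^ 2) (Y / Z ^ 3) := by
    simp only [Affine.negY, h₁, h₃, zero_mul, sub_zero]
    intro h
    have : 2 * (Y / Z ^ 3) = 0 := by linear_combination h
    exact mul_ne_zero h2 (div_ne_zero hy (pow_ne_zero 3 hz)) this
  have hs : Y / Z ^ 3 - W.negY (X / Z ^ 2) (Y / Z ^ 3) = 2 * Y / Z ^ 3 := by
    simp only [Affine.negY, h₁, h₃]; ring
  rw [Affine.Point.add_self_of_Y_ne hne]
  have hX : W.addX (X / Z ^ 2) (X / Z ^ 2)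
      (W.slope (X / Z ^ 2) (X / Z ^ 2) (Y / Z ^ 3) (Y / Z ^ 3)) =
      ((3 * X ^ 2 + W.a₄ * Z ^ 4) ^ 2 - 8 * (X * Y ^ 2)) / (2 * Y * Z) ^ 2 := by
    rw [Affine.slope_of_Y_ne rfl hne, hs]
    simp only [Affine.addX, h₁, h₂]
    field_simp
    ring
  have hY : W.addY (X / Z ^ 2) (X / Z ^ 2) (Y / Z ^ 3)
      (W.slope (X / Z ^ 2) (X / Z ^ 2) (Y / Z ^ 3) (Y / Z ^ 3)) =
      ((3 * X ^ 2 + W.a₄ * Z ^ 4) *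
        (4 * (X * Y ^ 2) - ((3 * X ^ 2 + W.a₄ * Z ^ 4) ^ 2 - 8 * (X * Y ^ 2))) - 8 * Y ^ 4) /
        (2 * Y * Z) ^ 3 := by
    rw [Affine.addY, Affine.negAddY, hX, Affine.slope_of_Y_ne rfl hne, hs]
    simp only [Affine.negY, h₁, h₂, h₃]
    field_simp
    ring
  have hn := Affine.nonsingular_add h h fun hxy => hne hxy.right
  exact ⟨hX ▸ hY ▸ hn, by simp only [hX, hY]⟩

theorem HasJacobianCoords.add_affine (h₁ : W.a₁ = 0) (h₂ : W.a₂ = 0) (h₃ : W.a₃ = 0)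
    {P : W.Point} {X Y Z x y : F} (hP : HasJacobianCoords P X Y Z) (h : W.Nonsingular x y)
    (hZ : Z * (x * Z ^ 2 - X) ≠ 0) :
    HasJacobianCoords (P + Affine.Point.some x y h)
      ((y * Z ^ 3 - Y) ^ 2 - (x * Z ^ 2 - X) ^ 3 - 2 * (X * (x * Z ^ 2 - X) ^ 2))
      ((y * Z ^ 3 - Y) * (X * (x * Z ^ 2 - X) ^ 2 -
        ((y * Z ^ 3 - Y) ^ 2 - (x * Z ^ 2 - X) ^ 3 - 2 * (X * (x * Z ^ 2 - X) ^ 2))) -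
        Y * (x * Z ^ 2 - X) ^ 3)
      (Z * (x * Z ^ 2 - X)) := by
  obtain ⟨h', rfl⟩ := hP
  have hz : Z ≠ 0 := left_ne_zero_of_mul hZ
  have hH : x * Z ^ 2 - X ≠ 0 := right_ne_zero_of_mul hZ
  have hne : X / Z ^ 2 ≠ x := by
    rintro rfl
    exact hH (by field_simp; ring)
  have hs : (Y / Z ^ 3 - y) / (X / Z ^ 2 - x) = (y * Z ^ 3 - Y) / (Z * (x * Z ^ 2 - X)) := by
    have : X / Z ^ 2 - x ≠ 0 := sub_ne_zero.mpr hne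
    rw [div_eq_div_iff this hZ]
    field_simp
    ring
  obtain ⟨H, hHx⟩ : ∃ H, H = x * Z ^ 2 - X := ⟨_, rfl⟩
  obtain ⟨R, hRy⟩ : ∃ R, R = y * Z ^ 3 - Y := ⟨_, rfl⟩
  rw [← hHx] at hH
  rw [← hHx, ← hRy] at hs ⊢
  have hx : x = (H + X) / Z ^ 2 := by rw [hHx]; field_simp; ring
  rw [Affine.Point.add_of_X_ne hne]
  have hX : W.addX (X / Z ^ 2) x (W.slope (X / Z ^ 2) x (Y / Z ^ 3) y) =
      (R ^ 2 - H ^ 3 - 2 * (X * H ^ 2)) / (Z * H) ^ 2 := by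
    rw [Affine.slope_of_X_ne hne, hs]
    simp only [Affine.addX, h₁, h₂]
    rw [hx]
    field_simp
    ring
  have hY : W.addY (X / Z ^ 2) x (Y / Z ^ 3) (W.slope (X / Z ^ 2) x (Y / Z ^ 3) y) =
      (R * (X * H ^ 2 - (R ^ 2 - H ^ 3 - 2 * (X * H ^ 2))) - Y * H ^ 3) / (Z * H) ^ 3 := by
    rw [Affine.addY, Affine.negAddY, hX, Affine.slope_of_X_ne hne, hs]
    simp only [Affine.negY, h₁, h₃]
    field_simp
    ring
  have hn := Affine.nonsingular_add h' h fun hxy => hne hxy.left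
  exact ⟨hX ▸ hY ▸ hn, by simp only [hX, hY]⟩

end Jacobian

/-- A Weierstrass curve over a finite field with `p` elements has at most `2 p + 1` points. -/
theorem card_point_le {F : Type*} [Field F] [Fintype F] (W : Affine F) :
    Finite W.Point ∧ Nat.card W.Point ≤ 2 * Fintype.card F + 1 := by
  classical
  let g : W.Point → Option (F × F)
    | .zero => none
    | .some x y _ => some (x, y)
  have hg : Function.Injective g := by
    rintro (_ | ⟨x, y, h⟩) (_ | ⟨x', y', h'⟩) hxy <;> simp_all [g]
  have hfin : Finite W.Point := Finite.of_injective g hg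
  refine ⟨hfin, ?_⟩
  have := Fintype.ofFinite W.Point
  let f : W.Point → Option F
    | .zero => none
    | .some x _ _ => some x
  have hzero : ((Finset.univ : Finset W.Point).filter fun P => f P = none).card ≤ 1 := by
    rw [Finset.card_le_one]
    rintro (_ | _) h (_ | _) h' <;> simp_all [f]
  have hsome (x : F) : ((Finset.univ : Finset W.Point).filter fun P => f P = some x).card ≤ 2 := by
    rcases Finset.eq_empty_or_nonempty
      ((Finset.univ : Finset W.Point).filter fun P => f P = some x) with he | ⟨Q, hQ⟩
    · simp [he]
    · refine (Finset.card_le_card (t := {Q, -Q}) fun P hP => ?_).trans Finset.card_le_two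
      rcases Q with _ | ⟨u, v, h⟩
      · simp [f] at hQ
      rcases P with _ | ⟨u', v', h'⟩
      · simp [f] at hP
      obtain rfl : u = x := by simpa [f] using hQ
      obtain rfl : u' = u := by simpa [f] using hP
      have := Affine.Y_eq_of_X_eq h'.1 h.1 rfl
      simpa [Affine.Point.neg_some] using this
  rw [Nat.card_eq_fintype_card, ← Finset.card_univ,
    Finset.card_eq_sum_card_fiberwise (f := f) (t := Finset.univ) (by simp), Fintype.sum_option]
  have := Finset.sum_le_card_nsmul (Finset.univ : Finset F) _ 2 fun x _ => hsome x
  simp only [smul_eq_mul, Finset.card_univ] at this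
  omega

/-- Evaluate `n` before passing it to `f`, to keep kernel reduction strict. -/
def strictApply {α : Type} (n : ℕ) (f : ℕ → α) : α :=
  Nat.rec (f 0) (fun k _ => f (k + 1)) n

@[simp]
theorem strictApply_eq {α : Type} (n : ℕ) (f : ℕ → α) : strictApply n f = f n := by
  cases n <;> rfl

/-- Jacobian doubling modulo `N`, in continuation-passing style; `c` represents `-1`. -/
def jacobianDouble {α : Type} (N c a X Y Z : ℕ) (k : ℕ → ℕ → ℕ → α) : α :=
  strictApply (X * Y ^ 2 % N) fun S =>
  strictApply ((3 * X ^ 2 + a * Z ^ 4) % N) fun M =>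
  strictApply ((M ^ 2 + c * (8 * S)) % N) fun X₂ =>
  strictApply ((M * (4 * S + c * X₂) + c * (8 * Y ^ 4)) % N) fun Y₂ =>
  strictApply (2 * Y * Z % N) fun Z₂ => k X₂ Y₂ Z₂

/-- Addition of the affine point `(x, y)` in Jacobian coordinates modulo `N`, in
continuation-passing style; `c` represents `-1`. -/
def jacobianAddAffine {α : Type} (N c x y X Y Z : ℕ) (k : ℕ → ℕ → ℕ → α) : α :=
  strictApply ((x * Z ^ 2 + c * X) % N) fun H =>
  strictApply ((y * Z ^ 3 + c * Y) % N) fun R =>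
  strictApply (X * H ^ 2 % N) fun V =>
  strictApply (H ^ 3 % N) fun G =>
  strictApply ((R ^ 2 + c * G + c * (2 * V)) % N) fun X₂ =>
  strictApply ((R * (V + c * X₂) + c * (Y * G)) % N) fun Y₂ =>
  strictApply (Z * H % N) fun Z₂ => k X₂ Y₂ Z₂

/-- Whether `(X : Y : Z)` is congruent to the negative of `(x, y)` modulo `N`. -/
def isNegCheck (N c x y X Y Z : ℕ) : Bool :=
  Nat.beq (X % N) (x * Z ^ 2 % N) && Nat.beq (Y % N) (c * (y * Z ^ 3) % N) &&
    Nat.beq (Nat.gcd Z N) 1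

/-- Process the lowest `i` bits of `n` by double-and-add, starting from `(X : Y : Z)`, and check
that the result is the negative of `(x, y)`. -/
def ladderCheck (N c a x y n : ℕ) (i : ℕ) : ℕ → ℕ → ℕ → Bool :=
  Nat.rec (isNegCheck N c x y)
    (fun i ih X Y Z => jacobianDouble N c a X Y Z fun X' Y' Z' =>
      cond (Nat.testBit n i) (jacobianAddAffine N c x y X' Y' Z' ih) (ih X' Y' Z')) i

section Ladder

variable {N c a x y p : ℕ} [Fact p.Prime]

theorem natCast_mod_of_dvd (hp : p ∣ N) (m : ℕ) : ((m % N : ℕ) : ZMod p) = m := by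
  rw [ZMod.natCast_eq_natCast_iff]
  exact (Nat.mod_modEq m N).of_dvd hp

theorem jacobianDouble_spec {W : Affine (ZMod p)} (h₁ : W.a₁ = 0) (h₂ : W.a₂ = 0) (h₃ : W.a₃ = 0)
    (h₄ : W.a₄ = a) (hp : p ∣ N) (hc : (c : ZMod p) = -1) {P : W.Point} {X Y Z : ℕ}
    (hP : (Z : ZMod p) ≠ 0 → HasJacobianCoords P (X : ZMod p) Y Z)
    {k : ℕ → ℕ → ℕ → Bool} (hk : jacobianDouble N c a X Y Z k = true) :
    ∃ X' Y' Z' : ℕ, k X' Y' Z' = true ∧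
      ((Z' : ZMod p) ≠ 0 → HasJacobianCoords (P + P) (X' : ZMod p) Y' Z') := by
  simp only [jacobianDouble, strictApply_eq] at hk
  refine ⟨_, _, _, hk, fun hZ => ?_⟩
  push_cast [natCast_mod_of_dvd hp, hc] at hZ ⊢
  have := (hP (right_ne_zero_of_mul hZ)).add_self h₁ h₂ h₃ hZ
  rw [h₄] at this
  convert this using 1 <;> ring

theorem jacobianAddAffine_spec {W : Affine (ZMod p)} (h₁ : W.a₁ = 0) (h₂ : W.a₂ = 0)
    (h₃ : W.a₃ = 0) (hp : p ∣ N) (hc : (c : ZMod p) = -1) {P : W.Point} {X Y Z : ℕ}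
    (h : W.Nonsingular (x : ZMod p) y)
    (hP : (Z : ZMod p) ≠ 0 → HasJacobianCoords P (X : ZMod p) Y Z)
    {k : ℕ → ℕ → ℕ → Bool} (hk : jacobianAddAffine N c x y X Y Z k = true) :
    ∃ X' Y' Z' : ℕ, k X' Y' Z' = true ∧ ((Z' : ZMod p) ≠ 0 →
      HasJacobianCoords (P + Affine.Point.some _ _ h) (X' : ZMod p) Y' Z') := by
  simp only [jacobianAddAffine, strictApply_eq] at hk
  refine ⟨_, _, _, hk, fun hZ => ?_⟩
  push_cast [natCast_mod_of_dvd hp, hc] at hZ ⊢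
  rw [neg_one_mul, ← sub_eq_add_neg] at hZ
  have := (hP (left_ne_zero_of_mul hZ)).add_affine h₁ h₂ h₃ h hZ
  convert this using 1 <;> ring

theorem ladderCheck_spec {W : Affine (ZMod p)} (h₁ : W.a₁ = 0) (h₂ : W.a₂ = 0) (h₃ : W.a₃ = 0)
    (h₄ : W.a₄ = a) (hp : p ∣ N) (hc : (c : ZMod p) = -1) (h : W.Nonsingular (x : ZMod p) y)
    {n : ℕ} (i : ℕ) : ∀ X Y Z : ℕ, ladderCheck N c a x y n i X Y Z = true →
      ((Z : ZMod p) ≠ 0 →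
        HasJacobianCoords ((n >>> i) • Affine.Point.some _ _ h) (X : ZMod p) Y Z) →
      n • Affine.Point.some _ _ h = -Affine.Point.some _ _ h := by
  induction i with
  | zero =>
    intro X Y Z hk hP
    change isNegCheck N c x y X Y Z = true at hk
    simp only [isNegCheck, Bool.and_eq_true, Nat.beq_eq] at hk
    obtain ⟨⟨hX, hY⟩, hZ⟩ := hk
    have hz : (Z : ZMod p) ≠ 0 := by
      rw [Ne, ZMod.natCast_eq_zero_iff]
      intro hd
      exact (Fact.out : p.Prime).one_lt.ne' (Nat.dvd_one.mp (hZ ▸ Nat.dvd_gcd hd hp))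
    obtain ⟨h', e⟩ := hP hz
    rw [Nat.shiftRight_zero] at e
    rw [e, Affine.Point.neg_some]
    have hX' := congrArg (Nat.cast : ℕ → ZMod p) hX
    have hY' := congrArg (Nat.cast : ℕ → ZMod p) hY
    push_cast [natCast_mod_of_dvd hp, hc] at hX' hY'
    rw [Affine.Point.some.injEq, hX', hY', Affine.negY, h₁, h₃]
    constructor
    · field_simp
    · field_simp
      ring
  | succ i ih =>
    intro X Y Z hk hP
    obtain ⟨X', Y', Z', hk, hP⟩ := jacobianDouble_spec h₁ h₂ h₃ h₄ hp hc hP hk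
    have hn : n >>> i = 2 * (n >>> (i + 1)) + (n.testBit i).toNat := by
      rw [Nat.shiftRight_succ, Nat.toNat_testBit, ← Nat.shiftRight_eq_div_pow]
      omega
    cases hb : n.testBit i with
    | false =>
      rw [hb] at hk hn
      refine ih X' Y' Z' hk ?_
      rwa [hn, Bool.toNat_false, add_zero, two_mul, add_smul]
    | true =>
      rw [hb] at hk hn
      obtain ⟨X'', Y'', Z'', hk, hP⟩ := jacobianAddAffine_spec h₁ h₂ h₃ hp hc h hP hk
      refine ih X'' Y'' Z'' hk ?_
      rwa [hn, Bool.toNat_true, add_smul, two_mul, add_smul, one_smul]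

end Ladder

/-- Certificate data: a modulus `N`, and a point `(x, y)` on a curve `Y² = X³ + a X + b`. -/
structure EllipticCert where
  N : ℕ
  a : ℕ
  x : ℕ
  y : ℕ

/-- Check that `(x, y)` is killed by `q`, and that `q` is large enough. -/
def EllipticCert.check (C : EllipticCert) (q : ℕ) : Bool :=
  Nat.blt 1 C.N && Nat.blt (4 * C.N) ((q - 1) ^ 2) && Nat.beq ((q - 1) >>> Nat.log2 (q - 1)) 1 &&
    Nat.beq (Nat.gcd (2 * C.y) C.N) 1 &&
    ladderCheck C.N (C.N - 1) C.a C.x C.y (q - 1) (Nat.log2 (q - 1)) C.x C.y 1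

theorem EllipticCert.prime_of_check {C : EllipticCert} {q : ℕ} (hq : q.Prime)
    (h : C.check q = true) : C.N.Prime := by
  simp only [EllipticCert.check, Bool.and_eq_true, Nat.blt_eq, Nat.beq_eq] at h
  obtain ⟨⟨⟨⟨hN, hlt⟩, hlog⟩, hy⟩, hl⟩ := h
  by_contra hnp
  set p := C.N.minFac with hpdef
  have hp : p.Prime := Nat.minFac_prime hN.ne'
  have : Fact p.Prime := ⟨hp⟩
  have hpN : p ∣ C.N := Nat.minFac_dvd _
  have hpsq : p ^ 2 ≤ C.N := Nat.minFac_sq_le_self (by omega) hnp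
  have hc : ((C.N - 1 : ℕ) : ZMod p) = -1 := by
    rw [Nat.cast_sub hN.le, (ZMod.natCast_eq_zero_iff _ _).mpr hpN]
    simp
  let W : Affine (ZMod p) := shortCurve (C.a : ZMod p) C.x C.y
  have hy2 : (2 * C.y : ZMod p) ≠ 0 := by
    intro h0
    have h0 : ((2 * C.y : ℕ) : ZMod p) = 0 := by exact_mod_cast h0
    rw [ZMod.natCast_eq_zero_iff] at h0
    exact hp.one_lt.ne' (Nat.dvd_one.mp (hy ▸ Nat.dvd_gcd h0 hpN))
  have hns : W.Nonsingular (C.x : ZMod p) C.y := by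
    rw [Affine.nonsingular_iff', Affine.equation_iff]
    refine ⟨by simp [W, shortCurve], Or.inr (by simpa [W, shortCurve] using hy2)⟩
  set Q : W.Point := Affine.Point.some _ _ hns with hQ
  have hmul : (q - 1) • Q = -Q := by
    refine ladderCheck_spec rfl rfl rfl rfl hpN hc hns _ _ _ _ hl fun _ => ?_
    rw [hlog, one_smul]
    exact ⟨by simpa using hns, by simp⟩
  have hkill : q • Q = 0 := by
    rw [← Nat.sub_add_cancel hq.one_le, add_smul, hmul, one_smul, neg_add_cancel]
  have hord : addOrderOf Q = q :=
    have := Fact.mk hq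
    addOrderOf_eq_prime hkill (by simp [hQ])
  obtain ⟨hfin, hcard⟩ := card_point_le W
  rw [ZMod.card] at hcard
  have hle : q ≤ Nat.card W.Point := hord ▸ Nat.le_of_dvd Nat.card_pos (addOrderOf_dvd_natCard Q)
  have hq2 : (q - 1) ^ 2 ≤ (2 * p) ^ 2 := Nat.pow_le_pow_left (by omega) 2
  rw [mul_pow] at hq2
  omega

/-- Check a list of certificates, each one relying on the primality of the next modulus and the
last one on the primality of `q`; the first modulus is `N`. -/
def chainCheck (q : ℕ) : List EllipticCert → ℕ → Bool
  | [], N => Nat.beq N q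
  | C :: cs, N => Nat.beq N C.N && C.check ((cs.head?.map EllipticCert.N).getD q) &&
      chainCheck q cs ((cs.head?.map EllipticCert.N).getD q)

theorem prime_of_chainCheck {q : ℕ} (hq : q.Prime) {cs : List EllipticCert} {N : ℕ}
    (h : chainCheck q cs N = true) : N.Prime := by
  induction cs generalizing N with
  | nil =>
    obtain rfl : N = q := by simpa [chainCheck] using h
    exact hq
  | cons C cs ih =>
    simp only [chainCheck, Bool.and_eq_true, Nat.beq_eq] at h
    obtain ⟨⟨rfl, hC⟩, hcs⟩ := h
    exact C.prime_of_check (ih hcs) hC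

/-- Elliptic curve primality certificate for `14` followed by `9` ones, ending in `49789`. -/
def fourteenChain : List EllipticCert := [
  ⟨14111111111,
    1428580906,
    6498021475,
    13084688812⟩,
  ⟨2486557,
    908484,
    1209723,
    751228⟩]

theorem prime_fourteen_append_ones : Nat.Prime (14 * 10 ^ 9 + (10 ^ 9 - 1) / 9) :=
  prime_of_chainCheck (cs := fourteenChain) (q := 49789) (by norm_num) (by decide +kernel)

/-- Elliptic curve primality certificate for `11` followed by `17` ones, ending in `26863`. -/
def elevenChain : List EllipticCert := [
  ⟨1111111111111111111,
    273471371829959966,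
    250414796108208991,
    120405373361686738⟩,
  ⟨196986516071,
    92138148226,
    37326992101,
    58622144781⟩,
  ⟨12918901,
    0,
    4573722,
    4150864⟩]

theorem prime_eleven_append_ones : Nat.Prime (11 * 10 ^ 17 + (10 ^ 17 - 1) / 9) :=
  prime_of_chainCheck (cs := elevenChain) (q := 26863) (by norm_num) (by decide +kernel)

/-- Elliptic curve primality certificate for `32` followed by `35` ones, ending in `1237`. -/
def thirtyTwoChain : List EllipticCert := [
  ⟨3211111111111111111111111111111111111,
    0,
    18517548207566193121543524949894796,
    1970412619705756562543862256872835535⟩,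
  ⟨128918668469025189823,
    55452080042429571322,
    122576349891741367776,
    57710841022150159061⟩,
  ⟨218689694705137,
    0,
    73481170816268,
    101762485259309⟩,
  ⟨138831487,
    0,
    103528155,
    98593810⟩,
  ⟨144013,
    0,
    118862,
    54119⟩]

theorem prime_thirtyTwo_append_ones : Nat.Prime (32 * 10 ^ 35 + (10 ^ 35 - 1) / 9) :=
  prime_of_chainCheck (cs := thirtyTwoChain) (q := 1237) (by norm_num) (by decide +kernel)

/-- Elliptic curve primality certificate for `12` followed by `136` ones, ending in `4951`. -/
def twelveChain : List EllipticCert := [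
  ⟨121111111111111111111111111111111111111111111111111111111111111111111111111111111111111111111111111111111111111111111111111111111111111111,
    39247677172475721907018158036162596153066301052632013211456260864879407538808714743914406193333107889135600181709951048452474405555161343,
    35655023216087060019237909599882755121248136021428129292005230636452939196458041517740453168119099777939407909951120990568120739791586760,
    83120592769693979825483432299465670286000259106793177103013581634603695809331011260679548322049584139742406630414367081567469472076622774⟩,
  ⟨25958225261382657962230734614917110861912148601837594673696058807906729096266969885631533257151599624592680827431723943513212245563,
    5399420665161646525066329354190141164201276423001311447604766868981262636390684651848940341220506150535076567055384706999635099405,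
    18638874252352804794536036761097185111807348541235189778963568091274570969014207372620967019056014959132615671469642194857293361699,
    11456963516385696126933798782771472532108035021281227544755790835615265290853150944497027197771947778579735636645732874486095306216⟩,
  ⟨1788002842084492213957207233428647944752179956043366488062822620736585000891428332290989190645794744265119341077073177258115799,
    1785694589015875260998695046298719721303992662863265338642603163907794239781355997655791166781328181458668963485667620002189903,
    740666183568240733758496678909942029625671440203111524782086644280305863328720663441214749987538995007336634929883421012622050,
    904406685779276323101436006901058434265574896028931285301400045970844240310492664827640473087639075367402405917149526903281985⟩,
  ⟨1898588920004762985156684291106413235856905617745989152088222203581240764230014059869079931241289783988674329647,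
    0,
    478140422237001821420170602740245699025474725652870255200434610837319171927082442078088325008330611990509502005,
    414562296540118862698942993790686415163062048976877618238847071555246301915028888153374074028685990894965112304⟩,
  ⟨1536928729529898677392248082882342877999639224737561190106648295474010384228176070669629438667699,
    1408642900425386994656067991621187457210413884030561161571810153594270045463396570561462495396331,
    1359408023725459336070841341499392844836140937781884884874402652460085825652728246147766948241905,
    617701149275534099172049920361962403106660976770086100860036891170046121848553624160759390027090⟩,
  ⟨104098383530445256774074364159827680264810881294069129578040968167504412442164895832046163,
    73924330471906499057214502513447742638640322828773554139186031481359095715094661367824743,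
    81873595014093945635877159330471038197505828732067810919264249139435963468114996517855980,
    62483893098105169882201400402120771988376476723335292153520933174248297622730813486853234⟩,
  ⟨83640496813413685253565134452667030268174824572118608213777330342479451031929,
    65350868332156614700589247671813075845644647073423030972191953455559486497965,
    72303910226057231734358155971052185256754581234767519090565810361458294626183,
    21477974864175847500291173019506129533876600463217801725601161976443781501019⟩,
  ⟨40334900756311487354734791210224559676799163486951787737520726753,
    28761911462259463616985361238931554190110186065043741784965524272,
    1567792603747475740803763910990730829363733701089896923598882999,
    33170677985967964198914258318267081471594939182263262708419444569⟩,
  ⟨61133048384642768391111298688310455260262304599079262129,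
    5985508667325484319890173535510383094395521792595281798,
    52891817956804689866223087793077466113052705789623249204,
    35681008012255575190498648507285343195394315567597174827⟩,
  ⟨17279917829475244464146422591139227781,
    6415305318618792633047474269176068498,
    4836187305618870246201132731435848227,
    15821790988910086921179452586199419628⟩,
  ⟨2092805183867748098532899,
    1602558301079360612410252,
    1143266080346692522207524,
    825100817465674425029576⟩,
  ⟨1971920539063334131,
    0,
    233991958853945025,
    439524751368618963⟩,
  ⟨44028970747,
    0,
    8430061439,
    11676579357⟩,
  ⟨612511,
    0,
    482220,
    232593⟩]

theorem prime_twelve_append_ones : Nat.Prime (12 * 10 ^ 136 + (10 ^ 136 - 1) / 9) :=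
  prime_of_chainCheck (cs := twelveChain) (q := 4951) (by norm_num) (by decide +kernel)

/-- Elliptic curve primality certificate for `17` followed by `8` ones, ending in `1117`. -/
def seventeenChain : List EllipticCert := [
  ⟨1711111111,
    0,
    451364075,
    138790510⟩,
  ⟨183373,
    116756,
    41560,
    37796⟩]

theorem prime_seventeen_append_ones : Nat.Prime (17 * 10 ^ 8 + (10 ^ 8 - 1) / 9) :=
  prime_of_chainCheck (cs := seventeenChain) (q := 1117) (by norm_num) (by decide +kernel)

/-- The residues of the repunits modulo `3 * 7 * 13 * 37`. -/
theorem repunit_mod (n : ℕ) : ∃ A, 10 ^ n = 9 * A + 1 ∧ (A % 10101 = 0 ∨ A % 10101 = 1 ∨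
    A % 10101 = 11 ∨ A % 10101 = 111 ∨ A % 10101 = 1111 ∨ A % 10101 = 1010) := by
  induction n with
  | zero => exact ⟨0, by norm_num, by norm_num⟩
  | succ n ih =>
    obtain ⟨A, hA, hmod⟩ := ih
    exact ⟨10 * A + 1, by rw [pow_succ, hA]; ring, by omega⟩

/-- Appending ones to `37` always gives a multiple of `3`, `7`, `13` or `37`. -/
theorem exists_dvd_append_ones (n : ℕ) :
    ∃ p ∈ ({3, 7, 13, 37} : Finset ℕ), p ∣ 37 * 10 ^ n + (10 ^ n - 1) / 9 := by
  obtain ⟨A, hA, hmod⟩ := repunit_mod n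
  have hval : 37 * 10 ^ n + (10 ^ n - 1) / 9 = 334 * A + 37 := by omega
  rw [hval]
  rcases hmod with h | h | h | h | h | h
  · exact ⟨37, by simp, by omega⟩
  · exact ⟨7, by simp, by omega⟩
  · exact ⟨3, by simp, by omega⟩
  · exact ⟨37, by simp, by omega⟩
  · exact ⟨13, by simp, by omega⟩
  · exact ⟨3, by simp, by omega⟩

/-- Each `k < 37` has a prime extension by ones. -/
theorem exists_prime_append_ones (k : ℕ) (hk : 1 ≤ k) (hk' : k < 37) :
    ∃ n : ℕ, 0 < n ∧ Nat.Prime (k * 10 ^ n + (10 ^ n - 1) / 9) := by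
  interval_cases k
  · exact ⟨1, by norm_num, by norm_num⟩
  · exact ⟨2, by norm_num, by norm_num⟩
  · exact ⟨1, by norm_num, by norm_num⟩
  · exact ⟨1, by norm_num, by norm_num⟩
  · exact ⟨5, by norm_num, by norm_num⟩
  · exact ⟨1, by norm_num, by norm_num⟩
  · exact ⟨1, by norm_num, by norm_num⟩
  · exact ⟨2, by norm_num, by norm_num⟩
  · exact ⟨2, by norm_num, by norm_num⟩
  · exact ⟨1, by norm_num, by norm_num⟩
  · exact ⟨17, by norm_num, prime_eleven_append_ones⟩
  · exact ⟨136, by norm_num, prime_twelve_append_ones⟩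
  · exact ⟨1, by norm_num, by norm_num⟩
  · exact ⟨9, by norm_num, prime_fourteen_append_ones⟩
  · exact ⟨1, by norm_num, by norm_num⟩
  · exact ⟨3, by norm_num, by norm_num⟩
  · exact ⟨8, by norm_num, prime_seventeen_append_ones⟩
  · exact ⟨1, by norm_num, by norm_num⟩
  · exact ⟨1, by norm_num, by norm_num⟩
  · exact ⟨2, by norm_num, by norm_num⟩
  · exact ⟨1, by norm_num, by norm_num⟩
  · exact ⟨3, by norm_num, by norm_num⟩
  · exact ⟨2, by norm_num, by norm_num⟩
  · exact ⟨1, by norm_num, by norm_num⟩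
  · exact ⟨1, by norm_num, by norm_num⟩
  · exact ⟨3, by norm_num, by norm_num⟩
  · exact ⟨1, by norm_num, by norm_num⟩
  · exact ⟨1, by norm_num, by norm_num⟩
  · exact ⟨6, by norm_num, by norm_num⟩
  · exact ⟨2, by norm_num, by norm_num⟩
  · exact ⟨1, by norm_num, by norm_num⟩
  · exact ⟨35, by norm_num, prime_thirtyTwo_append_ones⟩
  · exact ⟨1, by norm_num, by norm_num⟩
  · exact ⟨6, by norm_num, by norm_num⟩
  · exact ⟨2, by norm_num, by norm_num⟩
  · exact ⟨4, by norm_num, by norm_num⟩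

/-- For every integer `k` with `1 ≤ k < 37` there is a positive `n` such that
`k * 10^n + (10^n - 1) / 9` is prime; consequently `37` is the minimal seed for the
digit 1, i.e., the least positive integer all of whose digit-1 extensions are composite. -/
theorem stmt_4 :
    (∀ k : ℕ, 1 ≤ k → k < 37 →
      ∃ n : ℕ, 0 < n ∧ Nat.Prime (k * 10 ^ n + (10 ^ n - 1) / 9)) ∧
    IsLeast {k : ℕ | 0 < k ∧ ∀ n : ℕ, 0 < n →
      1 < k * 10 ^ n + (10 ^ n - 1) / 9 ∧
      ¬ Nat.Prime (k * 10 ^ n + (10 ^ n - 1) / 9)} 37 := by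
  refine ⟨exists_prime_append_ones, ⟨by norm_num, fun n hn => ?_⟩, fun k hk => ?_⟩
  · have h1 : 1 < 37 * 10 ^ n + (10 ^ n - 1) / 9 := by
      have := Nat.one_le_pow n 10 (by norm_num)
      omega
    refine ⟨h1, fun hprime => ?_⟩
    obtain ⟨p, hp, hdvd⟩ := exists_dvd_append_ones n
    have hlt : 37 * 10 ^ 1 ≤ 37 * 10 ^ n :=
      Nat.mul_le_mul_left _ (Nat.pow_le_pow_right (by norm_num) hn)
    rcases (Nat.dvd_prime hprime).mp hdvd with rfl | rfl
    · simp at hp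
    · simp only [Finset.mem_insert, Finset.mem_singleton] at hp
      omega
  · by_contra! hlt
    obtain ⟨n, hn, hprime⟩ := exists_prime_append_ones k hk.1 hlt
    exact (hk.2 n hn).2 hprime
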